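/- Let A be a bounded self-adjoint positive operator on ℓ²(ℤ, ℂ), banded with bandwidth b (⟨e_i, A e_k⟩ = 0 whenever |i−k| > b), with ‖A − I‖ ≤ r for some r < 1. Let Q be the unique positive square root of A, let Q_N := Π_N Q Π_N be the N-th central section of Q, and let Q̂_N be the unique positive semidefinite operator with Q̂_N² = Π_N A Π_N and Q̂_N = Π_N Q̂_N Π_N. Set R := Q_N Q̂_N − Q̂_N Q_N with entries r_{jk} = ⟨e_j, R e_k⟩. Then there is a constant K independent of N such that |r_{jk}| ≤ K r^{N/(4b)} for all N, all j with |j| ≤ N, and all k with |k| ≤ N/4 − 1. -/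

import Mathlib

open scoped ComplexInnerProductSpace

noncomputable abbrev l2Z : Type := lp (fun _ : ℤ => ℂ) 2

/-- the standard basis vector of `ℓ²(ℤ, ℂ)` -/
noncomputable def e (i : ℤ) : l2Z := lp.single 2 i 1

section

open Finset

/-- The coefficients of the Taylor series of `√(1 + x)` at `0`. -/
noncomputable abbrev sqrtCoeff (n : ℕ) : ℝ := Ring.choose (1 / 2 : ℝ) n

/-- The Taylor polynomial of degree `m` of `√(1 + x)`, evaluated at an element of an algebra. -/
noncomputable def sqrtTaylor {𝒜 : Type*} [Ring 𝒜] [Algebra ℂ 𝒜] (m : ℕ) (a : 𝒜) : 𝒜 :=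
  ∑ n ∈ range (m + 1), (sqrtCoeff n : ℂ) • a ^ n

lemma abs_sqrtCoeff_le_one (n : ℕ) : |sqrtCoeff n| ≤ 1 := by
  induction n with
  | zero => simp
  | succ n ih =>
    have h := Ring.choose_eq_smul (a := (1 / 2 : ℝ)) (n := n)
    have h' := Ring.choose_eq_smul (a := (1 / 2 : ℝ)) (n := n + 1)
    have hs : sqrtCoeff (n + 1) = sqrtCoeff n * ((1 / 2 - n) / (n + 1)) := by
      unfold sqrtCoeff
      rw [h', h, descPochhammer_succ_right, Polynomial.smeval_mul, Polynomial.smeval_sub,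
        Polynomial.smeval_X, Polynomial.smeval_natCast, Nat.factorial_succ]
      push_cast [smul_eq_mul, pow_one, pow_zero, nsmul_eq_mul]
      field_simp
    rw [hs, abs_mul]
    refine mul_le_one₀ ih (abs_nonneg _) ?_
    rw [abs_div, abs_of_pos (by positivity : (0 : ℝ) < n + 1), div_le_one (by positivity), abs_le]
    have : (0 : ℝ) ≤ n := n.cast_nonneg
    constructor <;> linarith

lemma hasSum_sqrtCoeff_mul_pow {x : ℝ} (hx : |x| < 1) :
    HasSum (fun n => sqrtCoeff n * x ^ n) √(1 + x) := by
  have h := (Real.one_add_rpow_hasFPowerSeriesOnBall_zero (a := 1 / 2)).hasSum (y := x)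
    (by simpa [enorm_eq_nnnorm, ← NNReal.coe_lt_coe] using hx)
  simpa only [binomialSeries_apply, Real.sqrt_eq_rpow, List.ofFn_const, List.prod_replicate,
    smul_eq_mul, zero_add] using h

lemma abs_sqrt_sub_sum_sqrtCoeff_le {x r : ℝ} (hx : |x| ≤ r) (hr : r < 1) (m : ℕ) :
    |√(1 + x) - ∑ n ∈ range (m + 1), sqrtCoeff n * x ^ n| ≤ r ^ (m + 1) / (1 - r) := by
  have h := (hasSum_nat_add_iff' (m + 1)).2 (hasSum_sqrtCoeff_mul_pow (hx.trans_lt hr))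
  have h0 : 0 ≤ r := (abs_nonneg x).trans hx
  have hg : HasSum (fun n => r ^ (n + (m + 1))) (r ^ (m + 1) / (1 - r)) := by
    simpa [pow_add, div_eq_inv_mul] using (hasSum_geometric_of_lt_one h0 hr).mul_right (r ^ (m + 1))
  refine h.norm_le_of_bounded hg fun n => ?_
  rw [norm_mul, norm_pow, Real.norm_eq_abs, Real.norm_eq_abs]
  calc |sqrtCoeff (n + (m + 1))| * |x| ^ (n + (m + 1)) ≤ 1 * r ^ (n + (m + 1)) := by
        gcongr; exact abs_sqrtCoeff_le_one _
    _ = _ := one_mul _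

lemma norm_sqrtTaylor_le {𝒜 : Type*} [NormedRing 𝒜] [NormOneClass 𝒜] [NormedAlgebra ℂ 𝒜]
    {a : 𝒜} {r : ℝ} (ha : ‖a‖ ≤ r) (hr : r < 1) (m : ℕ) : ‖sqrtTaylor m a‖ ≤ 1 / (1 - r) := by
  have h0 : 0 ≤ r := (norm_nonneg a).trans ha
  calc ‖sqrtTaylor m a‖ ≤ ∑ n ∈ range (m + 1), r ^ n := by
        refine norm_sum_le_of_le _ fun n _ => (norm_smul_le _ _).trans ?_
        calc ‖(sqrtCoeff n : ℂ)‖ * ‖a ^ n‖ ≤ 1 * r ^ n :=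
              mul_le_mul ((Complex.norm_real _).trans_le (abs_sqrtCoeff_le_one n))
                ((norm_pow_le a n).trans (pow_le_pow_left₀ (norm_nonneg a) ha n))
                (norm_nonneg _) zero_le_one
          _ = r ^ n := one_mul _
    _ ≤ ∑' n, r ^ n := (summable_geometric_of_lt_one h0 hr).sum_le_tsum _ fun n _ => by positivity
    _ = 1 / (1 - r) := by rw [tsum_geometric_of_lt_one h0 hr, one_div]

/-- If `s` is the positive square root of `1 + a` and `‖a‖ ≤ r < 1`, then the Taylor polynomial of
degree `m` approximates `s` up to `r ^ (m + 1) / (1 - r)`. -/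
lemma norm_sub_sqrtTaylor_le {𝒜 : Type*} [CStarAlgebra 𝒜] [PartialOrder 𝒜] [StarOrderedRing 𝒜]
    [Nontrivial 𝒜] {a s : 𝒜} {r : ℝ} (hs : 0 ≤ s) (hsa : s * s = 1 + a) (ha : ‖a‖ ≤ r) (hr : r < 1)
    (m : ℕ) : ‖s - sqrtTaylor m a‖ ≤ r ^ (m + 1) / (1 - r) := by
  have h0 : 0 ≤ r := (norm_nonneg a).trans ha
  have hsq : 0 ≤ 1 + a := hsa ▸ (IsSelfAdjoint.of_nonneg hs).mul_self_nonneg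
  have hasa : IsSelfAdjoint a := by
    simpa using (IsSelfAdjoint.of_nonneg hsq).sub (IsSelfAdjoint.one 𝒜)
  have hs' : s = cfc (fun x : ℝ => √(1 + x)) a := by
    rw [← CFC.sqrt_unique hsa hs, CFC.sqrt_eq_real_sqrt _ hsq, cfcₙ_eq_cfc,
      cfc_comp' Real.sqrt (fun x => 1 + x) a, cfc_const_add (1 : ℝ) (fun x => x) a, cfc_id' ℝ a,
      map_one]
  have ht : sqrtTaylor m a = cfc (fun x : ℝ => ∑ n ∈ range (m + 1), sqrtCoeff n * x ^ n) a := by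
    have h := cfc_sum (fun n (x : ℝ) => sqrtCoeff n * x ^ n) a (range (m + 1))
    rw [Finset.sum_fn] at h
    rw [h, sqrtTaylor]
    refine Finset.sum_congr rfl fun n _ => ?_
    rw [cfc_const_mul (sqrtCoeff n) (fun x : ℝ => x ^ n) a, cfc_pow_id a n]
    rfl
  rw [hs', ht, ← cfc_sub _ _ a]
  refine norm_cfc_le (by have := sub_pos.2 hr; positivity) fun x hx => ?_
  exact abs_sqrt_sub_sum_sqrtCoeff_le ((spectrum.norm_le_norm_of_mem hx).trans ha) hr m

lemma inner_e_left (i : ℤ) (v : l2Z) : ⟪e i, v⟫ = v i := by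
  simp [e, lp.inner_single_left]

lemma e_apply (i j : ℤ) : e i j = if j = i then 1 else 0 := by
  simp [e, Pi.single_apply]

/-- The closed subspace of sequences supported on the coordinates `|i| ≤ M`. -/
noncomputable def centralSubspace (M : ℤ) : Submodule ℂ l2Z :=
  (Submodule.span ℂ (e '' {i | M < |i|}))ᗮ

lemma mem_centralSubspace {M : ℤ} {v : l2Z} :
    v ∈ centralSubspace M ↔ ∀ i, M < |i| → v i = 0 := by
  rw [centralSubspace, Submodule.mem_orthogonal]
  constructor
  · intro h i hi
    rw [← inner_e_left]
    exact h _ (Submodule.subset_span ⟨i, hi, rfl⟩)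
  · intro h u hu
    induction hu using Submodule.span_induction with
    | mem x hx => obtain ⟨i, hi, rfl⟩ := hx; rw [inner_e_left, h i hi]
    | zero => simp
    | add x y _ _ hx hy => rw [inner_add_left, hx, hy, add_zero]
    | smul c x _ hx => rw [inner_smul_left, hx, mul_zero]

lemma e_mem_centralSubspace {M k : ℤ} (hk : |k| ≤ M) : e k ∈ centralSubspace M := by
  rw [mem_centralSubspace]
  intro i hi
  rw [e_apply, if_neg (by rintro rfl; omega)]

lemma centralSubspace_mono {M M' : ℤ} (h : M ≤ M') : centralSubspace M ≤ centralSubspace M' := by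
  intro v hv
  rw [mem_centralSubspace] at hv ⊢
  exact fun i hi => hv i (h.trans_lt hi)

instance (M : ℤ) : (centralSubspace M).HasOrthogonalProjection := by
  unfold centralSubspace
  infer_instance

instance : Nontrivial l2Z :=
  ⟨e 0, 0, fun h => by simpa [h] using e_apply 0 0⟩

/-- The orthogonal projection onto the coordinates `|i| ≤ N`. -/
noncomputable def centralProj (N : ℤ) : l2Z →L[ℂ] l2Z :=
  (centralSubspace N).starProjection

lemma isStarProjection_centralProj (N : ℤ) : IsStarProjection (centralProj N) :=
  isStarProjection_starProjection

lemma norm_centralProj_le (N : ℤ) : ‖centralProj N‖ ≤ 1 := 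
  Submodule.starProjection_norm_le _

lemma centralProj_eq_self {N : ℤ} {v : l2Z} (hv : v ∈ centralSubspace N) :
    centralProj N v = v := 
  Submodule.starProjection_eq_self_iff.2 hv

lemma centralProj_apply_mem (N : ℤ) (v : l2Z) : centralProj N v ∈ centralSubspace N := 
  Submodule.starProjection_apply_mem _ _

lemma centralProj_mul_self (N : ℤ) : centralProj N * centralProj N = centralProj N :=
  (isStarProjection_centralProj N).isIdempotentElem

lemma inner_centralProj_left (N : ℤ) (u v : l2Z) :
    ⟪centralProj N u, v⟫ = ⟪u, centralProj N v⟫ := by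
  have h := (isStarProjection_centralProj N).isSelfAdjoint
  rw [← ContinuousLinearMap.adjoint_inner_right, h.adjoint_eq]

lemma centralProj_apply (N : ℤ) (v : l2Z) (i : ℤ) :
    centralProj N v i = if |i| ≤ N then v i else 0 := by
  split_ifs with h
  · rw [← inner_e_left, ← inner_centralProj_left,
      centralProj_eq_self (e_mem_centralSubspace h), inner_e_left]
  · exact mem_centralSubspace.1 (centralProj_apply_mem N v) i (not_le.1 h)

lemma centralProj_e (N k : ℤ) : centralProj N (e k) = if |k| ≤ N then e k else 0 := by
  split_ifs with h
  · exact centralProj_eq_self (e_mem_centralSubspace h)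
  · ext i
    rw [centralProj_apply, e_apply]
    split_ifs with h1 h2
    · exact absurd (h2 ▸ h1) h
    all_goals simp

lemma clm_ext_of_inner_e {S T : l2Z →L[ℂ] l2Z} (h : ∀ i j, ⟪e i, S (e j)⟫ = ⟪e i, T (e j)⟫) :
    S = T := by
  refine lp.ext_continuousLinearMap (by simp) fun j => ContinuousLinearMap.ext_ring ?_
  ext i
  simpa only [inner_e_left] using! h i j

lemma inner_e_conj_centralProj (N : ℤ) (T : l2Z →L[ℂ] l2Z) (i j : ℤ) :
    ⟪e i, (centralProj N * T * centralProj N) (e j)⟫ =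
      if |i| ≤ N ∧ |j| ≤ N then ⟪e i, T (e j)⟫ else 0 := by
  simp only [mul_apply_eq_comp]
  rw [← inner_centralProj_left, centralProj_e, centralProj_e]
  split_ifs <;> simp_all

/-- A banded operator enlarges the central support by at most its bandwidth. -/
lemma apply_mem_centralSubspace {E : l2Z →L[ℂ] l2Z} {b : ℕ}
    (hE : ∀ i k : ℤ, |i - k| > (b : ℤ) → ⟪e i, E (e k)⟫ = 0) {M : ℤ} {v : l2Z}
    (hv : v ∈ centralSubspace M) : E v ∈ centralSubspace (M + b) := by
  rw [mem_centralSubspace] at hv ⊢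
  intro i hi
  rw [← inner_e_left, ← ContinuousLinearMap.adjoint_inner_left, lp.inner_eq_tsum]
  refine (tsum_congr fun l => ?_).trans tsum_zero
  by_cases hl : M < |l|
  · rw [hv l hl, inner_zero_right]
  · have h : (ContinuousLinearMap.adjoint E (e i) : l2Z) l = 0 := by
      rw [← inner_e_left l, ContinuousLinearMap.adjoint_inner_right, ← inner_conj_symm,
        hE i l (by cases abs_cases i <;> cases abs_cases l <;> cases abs_cases (i - l) <;> omega),
        map_zero]
    rw [h, inner_zero_left]

/-- Compressing to `|i| ≤ N` does not affect powers of a banded operator on vectors whose support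
stays within `|i| ≤ N`. -/
lemma conj_centralProj_pow_apply {E : l2Z →L[ℂ] l2Z} {b : ℕ}
    (hE : ∀ i k : ℤ, |i - k| > (b : ℤ) → ⟪e i, E (e k)⟫ = 0) {M N : ℤ} {v : l2Z}
    (hv : v ∈ centralSubspace M) (n : ℕ) (hn : M + n * b ≤ N) :
    ((centralProj N * E * centralProj N) ^ n) v = (E ^ n) v ∧
      (E ^ n) v ∈ centralSubspace (M + n * b) := by
  induction n with
  | zero => simpa using hv
  | succ n ih =>
    rw [Nat.cast_add_one] at hn ⊢
    have hb : (0 : ℤ) ≤ b := by positivity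
    obtain ⟨h1, h2⟩ := ih (by linarith)
    have h3 : (E ^ (n + 1)) v ∈ centralSubspace (M + (n + 1) * b) := by
      rw [pow_succ', mul_apply_eq_comp, add_one_mul, ← add_assoc]
      exact apply_mem_centralSubspace hE h2
    refine ⟨?_, h3⟩
    rw [pow_succ', mul_apply_eq_comp, h1, mul_apply_eq_comp, mul_apply_eq_comp,
      centralProj_eq_self (centralSubspace_mono (by linarith) h2), ← mul_apply_eq_comp E,
      ← pow_succ', centralProj_eq_self (centralSubspace_mono hn h3)]

/-- The Taylor polynomials of `√(1 + E)` and of `√(1 + P E P)` agree on vectors supported at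
distance at least `m * b` from the boundary of the central section. -/
lemma sqrtTaylor_conj_centralProj_apply {E : l2Z →L[ℂ] l2Z} {b : ℕ}
    (hE : ∀ i k : ℤ, |i - k| > (b : ℤ) → ⟪e i, E (e k)⟫ = 0) {M N : ℤ} {v : l2Z}
    (hv : v ∈ centralSubspace M) (m : ℕ) (hm : M + m * b ≤ N) :
    sqrtTaylor m (centralProj N * E * centralProj N) v = sqrtTaylor m E v ∧
      sqrtTaylor m E v ∈ centralSubspace (M + m * b) := by
  have hle : ∀ n ∈ range (m + 1), M + n * b ≤ M + m * b := fun n hn => by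
    have : n ≤ m := Nat.lt_succ_iff.1 (mem_range.1 hn)
    gcongr
  simp only [sqrtTaylor, _root_.sum_apply, smul_apply]
  constructor
  · refine Finset.sum_congr rfl fun n hn => ?_
    rw [(conj_centralProj_pow_apply hE hv n ((hle n hn).trans hm)).1]
  · refine Submodule.sum_mem _ fun n hn => Submodule.smul_mem _ _ ?_
    exact centralSubspace_mono (hle n hn) (conj_centralProj_pow_apply hE hv n le_rfl).2

lemma norm_commutator_sub_commutator_le {𝒜 : Type*} [NormedRing 𝒜] {x y x' y' : 𝒜} {c δ : ℝ}
    (hx : ‖x - x'‖ ≤ δ) (hy : ‖y - y'‖ ≤ δ) (hyc : ‖y‖ ≤ c) (hxc : ‖x'‖ ≤ c) :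
    ‖(x * y - y * x) - (x' * y' - y' * x')‖ ≤ 4 * c * δ := by
  have h : (x * y - y * x) - (x' * y' - y' * x') =
      ((x - x') * y - y * (x - x')) + (x' * (y - y') - (y - y') * x') := by noncomm_ring
  have h1 : ‖(x - x') * y‖ ≤ δ * c := norm_mul_le_of_le hx hyc
  have h2 : ‖y * (x - x')‖ ≤ c * δ := norm_mul_le_of_le hyc hx
  have h3 : ‖x' * (y - y')‖ ≤ c * δ := norm_mul_le_of_le hxc hy
  have h4 : ‖(y - y') * x'‖ ≤ δ * c := norm_mul_le_of_le hy hxc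
  rw [h]
  linarith [norm_add_le ((x - x') * y - y * (x - x')) (x' * (y - y') - (y - y') * x'),
    norm_sub_le ((x - x') * y) (y * (x - x')), norm_sub_le (x' * (y - y')) ((y - y') * x')]

lemma norm_conj_centralProj_le (N : ℤ) (T : l2Z →L[ℂ] l2Z) :
    ‖centralProj N * T * centralProj N‖ ≤ ‖T‖ := by
  have h := norm_centralProj_le N
  calc ‖centralProj N * T * centralProj N‖ ≤ 1 * ‖T‖ * 1 :=
        norm_mul_le_of_le (norm_mul_le_of_le h le_rfl) h
    _ = ‖T‖ := by ring

end

/-- Lemma 3.4 of the paper: with `A` positive, banded with bandwidth `b`, `‖A − I‖ ≤ r < 1`,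
`Q` its positive square root, `Q_N = Π_N Q Π_N` and `Q̂_N` the positive square root of
`Π_N A Π_N`, the commutator `R = Q_N Q̂_N − Q̂_N Q_N` has entries `r_{jk} = O(r^{N/(4b)})`
for `|j| ≤ N` and `|k| ≤ N/4 − 1`. -/
theorem stmt_5 (b : ℕ) (hb : 0 < b) (r : ℝ) (hr : r < 1)
    (A : l2Z →L[ℂ] l2Z) (hApos : A.IsPositive)
    (hband : ∀ i k : ℤ, |i - k| > (b : ℤ) → ⟪e i, A (e k)⟫ = 0)
    (hnorm : ‖A - 1‖ ≤ r)
    (Q : l2Z →L[ℂ] l2Z) (hQpos : Q.IsPositive) (hQ : Q ∘L Q = A)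
    (QN : ℕ → (l2Z →L[ℂ] l2Z))
    (hQN : ∀ (N : ℕ) (i j : ℤ),
      ⟪e i, QN N (e j)⟫ =
        if |i| ≤ (N : ℤ) ∧ |j| ≤ (N : ℤ) then ⟪e i, Q (e j)⟫ else 0)
    (Qh : ℕ → (l2Z →L[ℂ] l2Z))
    (hQhpos : ∀ N, (Qh N).IsPositive)
    (hQhsupp : ∀ (N : ℕ) (i j : ℤ), (|i| > (N : ℤ) ∨ |j| > (N : ℤ)) →
      ⟪e i, Qh N (e j)⟫ = 0)
    (hQhsq : ∀ (N : ℕ) (i j : ℤ),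
      ⟪e i, (Qh N ∘L Qh N) (e j)⟫ =
        if |i| ≤ (N : ℤ) ∧ |j| ≤ (N : ℤ) then ⟪e i, A (e j)⟫ else 0) :
    ∃ K : ℝ, ∀ (N : ℕ) (j k : ℤ), |j| ≤ (N : ℤ) → (|k| : ℝ) ≤ (N : ℝ) / 4 - 1 →
      ‖⟪e j, (QN N ∘L Qh N - Qh N ∘L QN N) (e k)⟫‖ ≤
        K * r ^ ((N : ℝ) / (4 * (b : ℝ))) := by
  have h0 : 0 ≤ r := (norm_nonneg _).trans hnorm
  have hr' : 0 < 1 - r := sub_pos.2 hr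
  set E : l2Z →L[ℂ] l2Z := A - 1 with hEdef
  have hE : ∀ i k : ℤ, |i - k| > (b : ℤ) → ⟪e i, E (e k)⟫ = 0 := fun i k hik => by
    have hne : i ≠ k := by
      rintro rfl
      simp at hik
      omega
    have h1 : (e k : l2Z) i = 0 := by rw [e_apply, if_neg hne]
    rw [hEdef, sub_apply, inner_sub_right, hband i k hik,
      one_apply_eq_self, inner_e_left, h1, sub_zero]
  refine ⟨8 / (1 - r) ^ 2, fun N j k _ hk => ?_⟩
  set P := centralProj N with hP
  have hPP : P * P = P := centralProj_mul_self N
  set m : ℕ := N / (4 * b)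
  have hmb : m * (4 * b) ≤ N := Nat.div_mul_le_self _ _
  have hkN : 4 * |k| ≤ (N : ℤ) := by
    have : 4 * (|k| : ℝ) ≤ N := by linarith
    exact_mod_cast this
  have hQN' : QN N = P * Q * P := clm_ext_of_inner_e fun i j => by
    rw [hQN, hP, inner_e_conj_centralProj]
  have hQh' : Qh N = P * Qh N * P := clm_ext_of_inner_e fun i j => by
    rw [hP, inner_e_conj_centralProj]
    split_ifs with h
    · rfl
    · exact hQhsupp N i j (by omega)
  have hQhsq' : Qh N * Qh N = P * A * P := clm_ext_of_inner_e fun i j => by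
    rw [hP, inner_e_conj_centralProj]
    exact hQhsq N i j
  have hPQh : P * Qh N = Qh N := by
    rw [hQh', ← mul_assoc, ← mul_assoc, hPP]
  have hQhP : Qh N * P = Qh N := by
    rw [hQh', mul_assoc, hPP]
  have hPpos : 0 ≤ 1 - P := (isStarProjection_centralProj N).one_sub.nonneg
  set T := Qh N + (1 - P) with hT
  have hTpos : 0 ≤ T :=
    add_nonneg ((ContinuousLinearMap.nonneg_iff_isPositive _).2 (hQhpos N)) hPpos
  have hTsq : T * T = 1 + P * E * P := by
    have : T * T = Qh N * Qh N + (Qh N - Qh N * P) + (Qh N - P * Qh N) + (1 - P - P + P * P) := by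
      rw [hT]; noncomm_ring
    rw [this, hPQh, hQhP, hQhsq', hEdef, mul_sub, sub_mul, mul_one, hPP]
    abel
  have hEP : ‖P * E * P‖ ≤ r := (norm_conj_centralProj_le N E).trans hnorm
  have hTapp := norm_sub_sqrtTaylor_le hTpos hTsq hEP hr m
  have hQpos' : 0 ≤ Q := (ContinuousLinearMap.nonneg_iff_isPositive _).2 hQpos
  have hQsq : Q * Q = 1 + E := by
    rw [hEdef, add_sub_cancel]
    exact hQ
  have hQapp := norm_sub_sqrtTaylor_le hQpos' hQsq hnorm hr m
  set q := sqrtTaylor m E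
  set t := sqrtTaylor m (P * E * P)
  have hqt : (P * q * P * t - t * (P * q * P)) (e k) = 0 := by
    have hb0 : (0 : ℤ) ≤ m * b := by positivity
    have hmN : |k| + m * b + m * b ≤ (N : ℤ) := by
      have : (m : ℤ) * (4 * b) ≤ N := by exact_mod_cast hmb
      linarith [abs_nonneg k]
    obtain ⟨h1, h2⟩ := sqrtTaylor_conj_centralProj_apply hE (e_mem_centralSubspace le_rfl) m
      (show |k| + m * b ≤ (N : ℤ) by linarith)
    obtain ⟨h3, h4⟩ := sqrtTaylor_conj_centralProj_apply hE h2 m hmN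
    simp only [sub_apply, mul_apply_eq_comp]
    rw [h1, centralProj_eq_self (e_mem_centralSubspace (show |k| ≤ (N : ℤ) by linarith)),
      centralProj_eq_self (centralSubspace_mono (show |k| + m * b ≤ (N : ℤ) by linarith) h2),
      h3, centralProj_eq_self (centralSubspace_mono hmN h4), sub_self]
  have hcomm : QN N * Qh N - Qh N * QN N = P * Q * P * T - T * (P * Q * P) := by
    have h1 : P * Q * P * (1 - P) = 0 := by rw [mul_sub, mul_one, mul_assoc _ P P, hPP, sub_self]
    have h2 : (1 - P) * (P * Q * P) = 0 := by
      rw [sub_mul, one_mul, ← mul_assoc, ← mul_assoc, hPP, sub_self]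
    rw [hQN', hT, mul_add, add_mul, h1, h2, add_zero, add_zero]
  have hxapp : ‖P * Q * P - P * q * P‖ ≤ r ^ (m + 1) / (1 - r) := by
    rw [← sub_mul, ← mul_sub]
    exact (norm_conj_centralProj_le N _).trans hQapp
  have hxc : ‖P * q * P‖ ≤ 2 / (1 - r) :=
    (norm_conj_centralProj_le N _).trans <| (norm_sqrtTaylor_le hnorm hr m).trans (by gcongr; simp)
  have hTc : ‖T‖ ≤ 2 / (1 - r) := by
    have h1 : r ^ (m + 1) / (1 - r) ≤ 1 / (1 - r) := by
      gcongr
      exact pow_le_one₀ h0 hr.le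
    have h2 := norm_le_norm_add_norm_sub' T t
    have h3 : 2 / (1 - r) = 1 / (1 - r) + 1 / (1 - r) := by ring
    linarith [norm_sqrtTaylor_le hEP hr m]
  have hmain := norm_commutator_sub_commutator_le hxapp hTapp hTc hxc
  have he : ‖e j‖ = 1 ∧ ‖e k‖ = 1 := by simp [e, lp.norm_single]
  have hpow : r ^ (m + 1) ≤ r ^ ((N : ℝ) / (4 * (b : ℝ))) := by
    rw [← Real.rpow_natCast]
    refine Real.rpow_le_rpow_of_exponent_ge' h0 hr.le (by positivity) ?_
    rw [div_le_iff₀ (by positivity)]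
    have : N ≤ (m + 1) * (4 * b) := (Nat.lt_mul_of_div_lt (Nat.lt_succ_self _) (by positivity)).le
    exact_mod_cast this
  calc ‖⟪e j, (QN N ∘L Qh N - Qh N ∘L QN N) (e k)⟫‖
      = ‖⟪e j, ((P * Q * P * T - T * (P * Q * P)) - (P * q * P * t - t * (P * q * P))) (e k)⟫‖ := by
        rw [sub_apply (P * Q * P * T - T * (P * Q * P)), hqt, sub_zero, ← hcomm]
        rfl
    _ ≤ ‖e j‖ * (‖(P * Q * P * T - T * (P * Q * P)) - (P * q * P * t - t * (P * q * P))‖ * ‖e k‖) :=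
        (norm_inner_le_norm _ _).trans (by gcongr; exact ContinuousLinearMap.le_opNorm _ _)
    _ ≤ 4 * (2 / (1 - r)) * (r ^ (m + 1) / (1 - r)) := by
        rw [he.1, he.2, one_mul, mul_one]
        exact hmain
    _ = 8 / (1 - r) ^ 2 * r ^ (m + 1) := by field_simp; ring
    _ ≤ _ := by gcongr
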